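/- arXiv:2507.02461 — 4 statements merged into one kernel-verified Lean document; each statement's English description precedes it below -/
import Mathlib

section
/- The log-partition function f(y) = log(tr(exp(∑_i y_i A_i))) − ⟨b, y⟩ is infinitely differentiable (C^∞) on ℝ^m and convex on all of ℝ^m. -/
open Matrix Filter
open scoped RealInnerProductSpace

/-- `A(y) = ∑ i, y i • A i`. -/
noncomputable def matA {n m : ℕ} (A : Fin m → Matrix (Fin n) (Fin n) ℝ)
    (y : EuclideanSpace ℝ (Fin m)) : Matrix (Fin n) (Fin n) ℝ :=
  ∑ i, y i • A i

/-- The log-partition function `f(y) = log tr exp A(y) - ⟨b, y⟩`. -/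
noncomputable def logPart {n m : ℕ} (A : Fin m → Matrix (Fin n) (Fin n) ℝ)
    (b : EuclideanSpace ℝ (Fin m)) (y : EuclideanSpace ℝ (Fin m)) : ℝ :=
  Real.log (Matrix.trace (NormedSpace.exp (matA A y))) - ⟪b, y⟫

/-- The linear map `𝒜(X) = (tr(A i * X))_i`. -/
noncomputable def Amap {n m : ℕ} (A : Fin m → Matrix (Fin n) (Fin n) ℝ)
    (X : Matrix (Fin n) (Fin n) ℝ) : EuclideanSpace ℝ (Fin m) :=
  WithLp.toLp 2 (fun i => Matrix.trace (A i * X))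

/-- The spectraplex: symmetric PSD matrices of unit trace. -/
def spectraplex (n : ℕ) : Set (Matrix (Fin n) (Fin n) ℝ) :=
  {X | X.IsSymm ∧ X.PosSemidef ∧ X.trace = 1}

/-- The moment body `ℳ = 𝒜(spectraplex)`. -/
noncomputable def momentBody {n m : ℕ} (A : Fin m → Matrix (Fin n) (Fin n) ℝ) :
    Set (EuclideanSpace ℝ (Fin m)) :=
  Amap A '' spectraplex n

/-- The trace-normalized matrix exponential `X(y)`. -/
noncomputable def densityMat {n m : ℕ} (A : Fin m → Matrix (Fin n) (Fin n) ℝ)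
    (y : EuclideanSpace ℝ (Fin m)) : Matrix (Fin n) (Fin n) ℝ :=
  (Matrix.trace (NormedSpace.exp (matA A y)))⁻¹ • NormedSpace.exp (matA A y)

namespace Matrix

variable {ι : Type*} [Fintype ι] [DecidableEq ι]

theorem exp_conj_transpose {V : Matrix ι ι ℝ} (hV : V * Vᵀ = 1) (X : Matrix ι ι ℝ) :
    NormedSpace.exp (V * X * Vᵀ) = V * NormedSpace.exp X * Vᵀ := by
  have hinv : V⁻¹ = Vᵀ := inv_eq_right_inv hV
  rw [← hinv]
  exact exp_conj V X (IsUnit.of_mul_eq_one _ hV)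

theorem trace_exp_conj_transpose {V : Matrix ι ι ℝ} (hV : V * Vᵀ = 1) (X : Matrix ι ι ℝ) :
    (NormedSpace.exp (V * X * Vᵀ)).trace = (NormedSpace.exp X).trace := by
  rw [exp_conj_transpose hV, trace_mul_comm, ← mul_assoc, mul_eq_one_comm.mp hV, one_mul]

/-- Real symmetric matrices are orthogonally diagonalizable. -/
theorem IsSymm.exists_orthogonal_diagonal {X : Matrix ι ι ℝ} (hX : X.IsSymm) :
    ∃ (V : Matrix ι ι ℝ) (d : ι → ℝ), V * Vᵀ = 1 ∧ X = V * diagonal d * Vᵀ := by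
  have hH : X.IsHermitian := by
    rw [IsHermitian, conjTranspose_eq_transpose_of_trivial]
    exact hX
  refine ⟨hH.eigenvectorUnitary, hH.eigenvalues, ?_, ?_⟩
  · rw [← conjTranspose_eq_transpose_of_trivial, ← star_eq_conjTranspose]
    exact Unitary.coe_mul_star_self hH.eigenvectorUnitary
  · conv_lhs => rw [hH.spectral_theorem, Unitary.conjStarAlgAut_apply]
    rw [← conjTranspose_eq_transpose_of_trivial, ← star_eq_conjTranspose]
    rfl

theorem exp_diagonal_real (d : ι → ℝ) :
    NormedSpace.exp (diagonal d) = diagonal fun i => Real.exp (d i) := by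
  rw [exp_diagonal]
  congr 1
  ext i
  rw [Pi.coe_exp, Real.exp_eq_exp_ℝ]

theorem mul_diagonal_mul_transpose_apply_self (V : Matrix ι ι ℝ) (d : ι → ℝ) (i : ι) :
    (V * diagonal d * Vᵀ) i i = ∑ j, V i j ^ 2 * d j := by
  rw [mul_apply]
  refine Finset.sum_congr rfl fun j _ => ?_
  rw [mul_diagonal, transpose_apply]
  ring

theorem IsSymm.exp_apply_self_le {X : Matrix ι ι ℝ} (hX : X.IsSymm) (i : ι) :
    Real.exp (X i i) ≤ NormedSpace.exp X i i := by
  obtain ⟨V, d, hV, rfl⟩ := hX.exists_orthogonal_diagonal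
  rw [exp_conj_transpose hV, exp_diagonal_real, mul_diagonal_mul_transpose_apply_self,
    mul_diagonal_mul_transpose_apply_self]
  refine convexOn_exp.map_sum_le (fun j _ => sq_nonneg (V i j)) ?_ fun j _ => Set.mem_univ (d j)
  simpa [mul_apply, sq] using congrFun (congrFun hV i) i

/-- The Peierls inequality for the trace of the exponential. -/
theorem IsSymm.sum_exp_diag_le_trace_exp {X : Matrix ι ι ℝ} (hX : X.IsSymm) :
    ∑ i, Real.exp (X i i) ≤ (NormedSpace.exp X).trace :=
  Finset.sum_le_sum fun i _ => hX.exp_apply_self_le i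

theorem IsSymm.trace_exp_pos [Nonempty ι] {X : Matrix ι ι ℝ} (hX : X.IsSymm) :
    0 < (NormedSpace.exp X).trace :=
  (Finset.sum_pos (fun _ _ => Real.exp_pos _) Finset.univ_nonempty).trans_le
    hX.sum_exp_diag_le_trace_exp

/-- `X ↦ log tr exp X` is convex on the real symmetric matrices. -/
theorem convexOn_log_trace_exp [Nonempty ι] :
    ConvexOn ℝ {X : Matrix ι ι ℝ | X.IsSymm}
      fun X => Real.log (NormedSpace.exp X).trace := by
  have hconv : Convex ℝ {X : Matrix ι ι ℝ | X.IsSymm} :=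
    fun X hX Y hY a b _ _ _ => (hX.smul a).add (hY.smul b)
  refine ⟨hconv, fun X hX Y hY a b ha hb hab => ?_⟩
  simp only [Set.mem_ofPred_eq, smul_eq_mul] at hX hY ⊢
  have hZ : (a • X + b • Y).IsSymm := hconv hX hY ha hb hab
  rw [Real.log_le_iff_le_exp hZ.trace_exp_pos]
  obtain ⟨V, d, hV, hd⟩ := hZ.exists_orthogonal_diagonal
  have hV' : Vᵀ * Vᵀᵀ = 1 := by rw [transpose_transpose, mul_eq_one_comm.mp hV]
  have hsum : ∀ {W : Matrix ι ι ℝ}, W.IsSymm →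
      ∑ i, Real.exp ((Vᵀ * W * V) i i - Real.log (NormedSpace.exp W).trace) ≤ 1 := by
    intro W hW
    have hsymm : (Vᵀ * W * V).IsSymm := by
      simp [IsSymm, transpose_mul, hW.eq, mul_assoc]
    have hle := hsymm.sum_exp_diag_le_trace_exp
    rw [show (NormedSpace.exp (Vᵀ * W * V)).trace = (NormedSpace.exp W).trace by
      simpa using trace_exp_conj_transpose hV' W] at hle
    simp_rw [Real.exp_sub, Real.exp_log hW.trace_exp_pos]
    rw [← Finset.sum_div]
    exact (div_le_one hW.trace_exp_pos).2 hle
  have hdiag : ∀ i, d i = a * (Vᵀ * X * V) i i + b * (Vᵀ * Y * V) i i := by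
    have h : diagonal d = a • (Vᵀ * X * V) + b • (Vᵀ * Y * V) := by
      have hVd : Vᵀ * (V * diagonal d * Vᵀ) * V = diagonal d := by
        simp only [mul_assoc, mul_eq_one_comm.mp hV, mul_one]
        rw [← mul_assoc, mul_eq_one_comm.mp hV, one_mul]
      rw [← hVd, ← hd]
      simp [mul_add, add_mul]
    intro i
    simpa using congrFun (congrFun h i) i
  have htr : (NormedSpace.exp (a • X + b • Y)).trace = ∑ i, Real.exp (d i) := by
    rw [hd, trace_exp_conj_transpose hV, exp_diagonal_real, trace_diagonal]
  set x := Real.log (NormedSpace.exp X).trace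
  set y := Real.log (NormedSpace.exp Y).trace
  have hone : ∑ i, Real.exp (d i - (a * x + b * y)) ≤ 1 := calc
    _ ≤ ∑ i, (a * Real.exp ((Vᵀ * X * V) i i - x) + b * Real.exp ((Vᵀ * Y * V) i i - y)) := by
      refine Finset.sum_le_sum fun i _ => ?_
      rw [hdiag, show ∀ p q : ℝ, a * p + b * q - (a * x + b * y) = a * (p - x) + b * (q - y) by
        intros; ring]
      exact convexOn_exp.2 (Set.mem_univ _) (Set.mem_univ _) ha hb hab
    _ = a * ∑ i, Real.exp ((Vᵀ * X * V) i i - x) + b * ∑ i, Real.exp ((Vᵀ * Y * V) i i - y) := by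
      rw [Finset.sum_add_distrib, Finset.mul_sum, Finset.mul_sum]
    _ ≤ a * 1 + b * 1 := by gcongr <;> exact hsum ‹_›
    _ = 1 := by rw [mul_one, mul_one, hab]
  simp_rw [Real.exp_sub] at hone
  rw [← Finset.sum_div, div_le_one (Real.exp_pos _)] at hone
  exact htr.trans_le hone

open scoped Norms.Operator in
theorem contDiff_trace_exp {E : Type*} [NormedAddCommGroup E] [NormedSpace ℝ E] {k : WithTop ℕ∞}
    (L : E →L[ℝ] Matrix ι ι ℝ) :
    ContDiff ℝ k fun y => (NormedSpace.exp (L y)).trace := by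
  have hexp : ContDiff ℝ k (NormedSpace.exp : Matrix ι ι ℝ → Matrix ι ι ℝ) :=
    contDiff_iff_contDiffAt.2 fun X =>
      (NormedSpace.exp_analytic (𝕂 := ℝ) X).contDiffAt
  exact (LinearMap.toContinuousLinearMap (traceLinearMap ι ℝ ℝ)).contDiff.comp
    (hexp.comp L.contDiff)

end Matrix

/-- `matA A` as a linear map. -/
noncomputable def matALinearMap {n m : ℕ} (A : Fin m → Matrix (Fin n) (Fin n) ℝ) :
    EuclideanSpace ℝ (Fin m) →ₗ[ℝ] Matrix (Fin n) (Fin n) ℝ where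
  toFun := matA A
  map_add' y z := by simp [matA, add_smul, Finset.sum_add_distrib]
  map_smul' c y := by simp [matA, mul_smul, Finset.smul_sum]

theorem isSymm_matA {n m : ℕ} {A : Fin m → Matrix (Fin n) (Fin n) ℝ} (hA : ∀ i, (A i)ᵀ = A i)
    (y : EuclideanSpace ℝ (Fin m)) : (matA A y).IsSymm := by
  simp [Matrix.IsSymm, matA, Matrix.transpose_sum, hA]

/-- the log-partition function is C^∞ and convex on ℝ^m. -/
theorem stmt0 (n m : ℕ) (hn : 1 ≤ n)
    (A : Fin m → Matrix (Fin n) (Fin n) ℝ) (hA : ∀ i, (A i)ᵀ = A i)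
    (b : EuclideanSpace ℝ (Fin m)) :
    ContDiff ℝ (⊤ : ℕ∞) (logPart A b) ∧ ConvexOn ℝ Set.univ (logPart A b) := by
  have : Nonempty (Fin n) := ⟨⟨0, hn⟩⟩
  constructor
  · refine ContDiff.sub (ContDiff.log ?_ fun y => (isSymm_matA hA y).trace_exp_pos.ne')
      (contDiff_const.inner ℝ contDiff_id)
    exact Matrix.contDiff_trace_exp (LinearMap.toContinuousLinearMap (matALinearMap A))
  · have hconv := Matrix.convexOn_log_trace_exp.comp_linearMap (matALinearMap A)
    rw [show matALinearMap A ⁻¹' {X | X.IsSymm} = Set.univ from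
      Set.eq_univ_of_forall (isSymm_matA hA)] at hconv
    exact hconv.sub ((innerₛₗ ℝ b).concaveOn convex_univ)
end

section
/- For every y ∈ ℝ^m the log-partition function f is differentiable at y and its gradient is given coordinatewise by (∇f(y))_i = tr(A_i · X(y)) − b_i, where X(y) := exp(A(y)) / tr(exp(A(y))) is the trace-normalized matrix exponential. -/
open Matrix Filter
open scoped RealInnerProductSpace

section TracialExp

variable {𝔸 : Type*} [NormedRing 𝔸] [NormedAlgebra ℝ 𝔸]

/-- The derivative of `a ↦ τ (a ^ (k + 1))` for a functional `τ` with `τ (a * c) = τ (c * a)`. -/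
theorem hasFDerivAt_tracial_pow (τ : 𝔸 →L[ℝ] ℝ) (hτ : ∀ a c, τ (a * c) = τ (c * a))
    (k : ℕ) (x : 𝔸) :
    HasFDerivAt (fun a => τ (a ^ (k + 1)))
      (((k : ℝ) + 1) • τ ∘L ContinuousLinearMap.mul ℝ 𝔸 (x ^ k)) x := by
  refine (τ.hasFDerivAt.comp x (hasFDerivAt_pow' (𝕜 := ℝ) (k + 1))).congr_fderiv ?_
  ext h
  have key : ∀ i ∈ Finset.range (k + 1), τ (x ^ (k - i) * h * x ^ i) = τ (x ^ k * h) := by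
    intro i hi
    have hik : i + (k - i) = k := by have := Finset.mem_range.1 hi; omega
    rw [hτ, ← mul_assoc, ← pow_add, hik]
  simpa [_root_.sum_apply] using Finset.sum_congr rfl key

variable [NormOneClass 𝔸] [CompleteSpace 𝔸]

/-- The derivative of `a ↦ τ (exp a)` for a functional `τ` with `τ (a * c) = τ (c * a)`. -/
theorem hasFDerivAt_tracial_exp (τ : 𝔸 →L[ℝ] ℝ) (hτ : ∀ a c, τ (a * c) = τ (c * a)) (x : 𝔸) :
    HasFDerivAt (fun a => τ (NormedSpace.exp a))
      (τ ∘L ContinuousLinearMap.mul ℝ 𝔸 (NormedSpace.exp x)) x := by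
  let L : 𝔸 →L[ℝ] 𝔸 →L[ℝ] ℝ :=
    ContinuousLinearMap.compL ℝ 𝔸 𝔸 ℝ τ ∘L ContinuousLinearMap.mul ℝ 𝔸
  have hsum (a : 𝔸) : HasSum (fun k : ℕ => ((k.factorial : ℝ)⁻¹) • a ^ k) (NormedSpace.exp a) :=
    NormedSpace.exp_series_hasSum_exp' a
  have hval (a : 𝔸) : HasSum (fun k : ℕ => (((k + 1).factorial : ℝ)⁻¹) * τ (a ^ (k + 1)))
      (τ (NormedSpace.exp a) - τ 1) := by
    have h := (hasSum_nat_add_iff' 1).2 (τ.hasSum (hsum a))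
    simpa using h
  have hder : HasSum (fun k : ℕ => ((k.factorial : ℝ)⁻¹) • L (x ^ k)) (L (NormedSpace.exp x)) := by
    simpa using L.hasSum (hsum x)
  set R : ℝ := ‖x‖ + 1
  have hu : Summable fun k : ℕ => ‖L‖ * (R ^ k / k.factorial) :=
    (Real.summable_pow_div_factorial R).mul_left _
  have hmem : x ∈ Metric.ball (0 : 𝔸) R := by simp [R]
  have hts := hasFDerivAt_tsum_of_isPreconnected (𝕜 := ℝ)
    (f := fun (k : ℕ) (a : 𝔸) => (((k + 1).factorial : ℝ)⁻¹) * τ (a ^ (k + 1)))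
    (f' := fun k a => ((k.factorial : ℝ)⁻¹) • L (a ^ k)) hu Metric.isOpen_ball
    (convex_ball (0 : 𝔸) R).isPreconnected ?_ ?_ hmem (hval x).summable hmem
  · rw [hder.tsum_eq] at hts
    simp_rw [fun a => (hval a).tsum_eq] at hts
    exact (hts.add_const (τ 1)).congr_of_eventuallyEq (.of_forall fun a => by simp)
  · intro k a _
    refine ((hasFDerivAt_tracial_pow τ hτ k a).const_mul _).congr_fderiv ?_
    rw [smul_smul, Nat.factorial_succ]
    congr 1
    push_cast
    field_simp
  · intro k a ha
    have haR : ‖a‖ ≤ R := (mem_ball_zero_iff.1 ha).le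
    calc ‖((k.factorial : ℝ)⁻¹) • L (a ^ k)‖ = (k.factorial : ℝ)⁻¹ * ‖L (a ^ k)‖ := by
          rw [norm_smul]; simp
      _ ≤ (k.factorial : ℝ)⁻¹ * (‖L‖ * R ^ k) := by
          gcongr
          exact (L.le_opNorm _).trans (by gcongr; exact (norm_pow_le a k).trans (by gcongr))
      _ = ‖L‖ * (R ^ k / k.factorial) := by ring

end TracialExp

theorem trace_exp_pos_of_isSymm {ι : Type*} [Fintype ι] [DecidableEq ι] [Nonempty ι]
    {M : Matrix ι ι ℝ} (hM : M.IsSymm) : 0 < Matrix.trace (NormedSpace.exp M) := by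
  set S := NormedSpace.exp ((2 : ℝ)⁻¹ • M)
  have hS : Sᴴ = S := by
    rw [conjTranspose_eq_transpose_of_trivial]
    exact (hM.smul _).exp
  have hSS : NormedSpace.exp M = Sᴴ * S := by
    rw [hS, ← Matrix.exp_add_of_commute _ _ (Commute.refl _), ← add_smul]
    norm_num
  rw [hSS]
  exact (Matrix.PosDef.conjTranspose_mul_self S
    (Matrix.mulVec_injective_of_isUnit (Matrix.isUnit_exp _))).trace_pos

open scoped Matrix.Norms.Operator in
theorem hasFDerivAt_trace_exp_comp {E ι : Type*} [NormedAddCommGroup E] [NormedSpace ℝ E]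
    [FiniteDimensional ℝ E] [Fintype ι] [DecidableEq ι] [Nonempty ι]
    (T : E →ₗ[ℝ] Matrix ι ι ℝ) (y : E) :
    HasFDerivAt (fun z => Matrix.trace (NormedSpace.exp (T z)))
      (LinearMap.toContinuousLinearMap
        (Matrix.traceLinearMap ι ℝ ℝ ∘ₗ LinearMap.mulLeft ℝ (NormedSpace.exp (T y)) ∘ₗ T)) y := by
  let τ : Matrix ι ι ℝ →L[ℝ] ℝ := LinearMap.toContinuousLinearMap (Matrix.traceLinearMap ι ℝ ℝ)
  have hτ := hasFDerivAt_tracial_exp τ (fun a c => Matrix.trace_mul_comm a c) (T y)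
  exact (hτ.comp y (LinearMap.toContinuousLinearMap T).hasFDerivAt).congr_fderiv (by ext; rfl)

/-- differentiability and coordinatewise gradient formula. -/
theorem stmt1 (n m : ℕ) (hn : 1 ≤ n)
    (A : Fin m → Matrix (Fin n) (Fin n) ℝ) (hA : ∀ i, (A i)ᵀ = A i)
    (b : EuclideanSpace ℝ (Fin m)) (y : EuclideanSpace ℝ (Fin m)) :
    DifferentiableAt ℝ (logPart A b) y ∧
    ∀ i, gradient (logPart A b) y i = Matrix.trace (A i * densityMat A y) - b i := by
  have : Nonempty (Fin n) := ⟨⟨0, hn⟩⟩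
  let T : EuclideanSpace ℝ (Fin m) →ₗ[ℝ] Matrix (Fin n) (Fin n) ℝ :=
    { toFun := matA A
      map_add' := fun u v => by simp [matA, add_smul, Finset.sum_add_distrib]
      map_smul' := fun c u => by simp [matA, Finset.smul_sum, smul_smul] }
  have hsymm : (matA A y).IsSymm := by
    simp [Matrix.IsSymm, matA, Matrix.transpose_sum, hA]
  have hpos := trace_exp_pos_of_isSymm hsymm
  have hlog := ((hasFDerivAt_trace_exp_comp T y).log hpos.ne').sub (innerSL ℝ b).hasFDerivAt
  have hf : HasFDerivAt (logPart A b) _ y := hlog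
  refine ⟨hf.differentiableAt, fun i => ?_⟩
  have hT : T (EuclideanSpace.single i 1) = A i := by
    change matA A _ = _
    simp [matA]
  have hcoord : gradient (logPart A b) y i
      = fderiv ℝ (logPart A b) y (EuclideanSpace.single i 1) := by
    rw [← toDual_gradient, InnerProductSpace.toDual_apply_apply,
      EuclideanSpace.inner_single_right]
    simp
  rw [hcoord, hf.fderiv]
  have hTy : T y = matA A y := rfl
  simp [hT, hTy, densityMat, EuclideanSpace.inner_single_right, Matrix.trace_mul_comm (A i)]
end

section
/- Assume the identity matrix I_n together with A_1, …, A_m are linearly independent. Then the log-partition function f is coercive (f(y) → +∞ as ‖y‖ → ∞, i.e., f tends to atTop along the cocompact filter) if and only if b lies in the interior of the moment body ℳ. -/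
open Matrix Filter
open scoped RealInnerProductSpace

theorem Matrix.IsSymm.exists_eq_mul_diagonal_mul_transpose {n : ℕ} {H : Matrix (Fin n) (Fin n) ℝ}
    (hH : H.IsSymm) : ∃ (U : Matrix (Fin n) (Fin n) ℝ) (d : Fin n → ℝ),
      Uᵀ * U = 1 ∧ U * Uᵀ = 1 ∧ H = U * diagonal d * Uᵀ := by
  have hH' : H.IsHermitian := by
    rw [IsHermitian, conjTranspose_eq_transpose_of_trivial, hH.eq]
  refine ⟨hH'.eigenvectorUnitary, hH'.eigenvalues, ?_, ?_, ?_⟩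
  · simpa [star_eq_conjTranspose, conjTranspose_eq_transpose_of_trivial] using
      Unitary.coe_star_mul_self hH'.eigenvectorUnitary
  · simpa [star_eq_conjTranspose, conjTranspose_eq_transpose_of_trivial] using
      Unitary.coe_mul_star_self hH'.eigenvectorUnitary
  · conv_lhs => rw [hH'.spectral_theorem, Unitary.conjStarAlgAut_apply]
    rw [star_eq_conjTranspose, conjTranspose_eq_transpose_of_trivial]
    rfl

theorem trace_exp_mul_diagonal_mul_transpose {n : ℕ} {U : Matrix (Fin n) (Fin n) ℝ}
    (hU : Uᵀ * U = 1) (hU' : U * Uᵀ = 1) (d : Fin n → ℝ) :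
    trace (NormedSpace.exp (U * diagonal d * Uᵀ)) = ∑ i, Real.exp (d i) := by
  have h := exp_units_conj (⟨U, Uᵀ, hU', hU⟩ : (Matrix (Fin n) (Fin n) ℝ)ˣ) (diagonal d)
  simp only [Units.inv_mk] at h
  rw [h, trace_mul_comm, ← mul_assoc, hU, one_mul, exp_diagonal, trace_diagonal]
  simp [Pi.coe_exp, Real.exp_eq_exp_ℝ]

/-- Every state gives a lower bound for the log-partition function. -/
theorem trace_mul_le_log_trace_exp {n : ℕ} {H X : Matrix (Fin n) (Fin n) ℝ}
    (hH : H.IsSymm) (hX : X ∈ spectraplex n) :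
    trace (H * X) ≤ Real.log (trace (NormedSpace.exp H)) := by
  obtain ⟨U, d, hU, hU', rfl⟩ := hH.exists_eq_mul_diagonal_mul_transpose
  obtain ⟨-, hpos, htr⟩ := hX
  rw [trace_exp_mul_diagonal_mul_transpose hU hU']
  have hP : (Uᵀ * X * U).PosSemidef := by
    simpa [conjTranspose_eq_transpose_of_trivial] using hpos.conjTranspose_mul_mul_same U
  have hPtr : ∑ i, (Uᵀ * X * U) i i = 1 := by
    change trace (Uᵀ * X * U) = 1
    rw [trace_mul_comm, ← mul_assoc, hU', one_mul, htr]
  have hle (i : Fin n) : d i ≤ Real.log (∑ j, Real.exp (d j)) := by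
    rw [← Real.log_exp (d i)]
    exact Real.log_le_log (Real.exp_pos _)
      (Finset.single_le_sum (f := fun j => Real.exp (d j)) (fun j _ => (Real.exp_pos _).le)
        (Finset.mem_univ i))
  calc trace (U * diagonal d * Uᵀ * X)
      = trace (diagonal d * (Uᵀ * X * U)) := by
        rw [mul_assoc, mul_assoc, trace_mul_comm, mul_assoc]
    _ = ∑ i, d i * (Uᵀ * X * U) i i := by simp [trace, diagonal_mul]
    _ ≤ ∑ i, Real.log (∑ j, Real.exp (d j)) * (Uᵀ * X * U) i i :=
        Finset.sum_le_sum fun i _ => mul_le_mul_of_nonneg_right (hle i) hP.diag_nonneg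
    _ = Real.log (∑ j, Real.exp (d j)) := by rw [← Finset.mul_sum, hPtr, mul_one]

/-- The log-partition function exceeds the maximal energy of a state by at most `log n`. -/
theorem log_trace_exp_le_of_forall_trace_mul_le {n : ℕ} (hn : 1 ≤ n)
    {H : Matrix (Fin n) (Fin n) ℝ} (hH : H.IsSymm) {c : ℝ}
    (hc : ∀ X ∈ spectraplex n, trace (H * X) ≤ c) :
    Real.log (trace (NormedSpace.exp H)) ≤ Real.log n + c := by
  obtain ⟨U, d, hU, hU', rfl⟩ := hH.exists_eq_mul_diagonal_mul_transpose
  rw [trace_exp_mul_diagonal_mul_transpose hU hU']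
  have hd (i : Fin n) : d i ≤ c := by
    have hS : (diagonal (Pi.single i (1 : ℝ))).PosSemidef :=
      PosSemidef.diagonal (Pi.single_nonneg.2 zero_le_one)
    have hX : U * diagonal (Pi.single i (1 : ℝ)) * Uᵀ ∈ spectraplex n := by
      refine ⟨?_, ?_, ?_⟩
      · simp [IsSymm, transpose_mul, mul_assoc]
      · simpa [conjTranspose_eq_transpose_of_trivial] using hS.mul_mul_conjTranspose_same U
      · rw [trace_mul_comm, ← mul_assoc, hU, one_mul, trace_diagonal]
        simp
    have h := hc _ hX
    have key : U * diagonal d * Uᵀ * (U * diagonal (Pi.single i (1 : ℝ)) * Uᵀ)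
        = U * (diagonal d * diagonal (Pi.single i (1 : ℝ)) * Uᵀ) := by
      simp only [mul_assoc]
      rw [← mul_assoc Uᵀ U, hU, one_mul]
    rw [key, trace_mul_comm, mul_assoc, hU, mul_one, diagonal_mul_diagonal, trace_diagonal] at h
    simpa [Pi.single_apply] using h
  have hn' : (0 : ℝ) < n := by exact_mod_cast hn
  have : Nonempty (Fin n) := ⟨⟨0, hn⟩⟩
  calc Real.log (∑ i, Real.exp (d i)) ≤ Real.log (n * Real.exp c) := by
        refine Real.log_le_log (Finset.sum_pos (fun i _ => Real.exp_pos _)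
          Finset.univ_nonempty) ?_
        calc ∑ i, Real.exp (d i) ≤ ∑ _i : Fin n, Real.exp c :=
              Finset.sum_le_sum fun i _ => Real.exp_le_exp.2 (hd i)
          _ = n * Real.exp c := by simp
    _ = Real.log n + c := by
        rw [Real.log_mul hn'.ne' (Real.exp_pos c).ne', Real.log_exp]

theorem convex_spectraplex (n : ℕ) : Convex ℝ (spectraplex n) := by
  rintro X ⟨hXs, hXp, hXt⟩ Y ⟨hYs, hYp, hYt⟩ s t hs ht hst
  refine ⟨(hXs.smul s).add (hYs.smul t), (hXp.smul hs).add (hYp.smul ht), ?_⟩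
  simp [trace_add, trace_smul, hXt, hYt, hst]

theorem spectraplex_nonempty {n : ℕ} (hn : 1 ≤ n) : (spectraplex n).Nonempty := by
  have hn' : (n : ℝ) ≠ 0 := by exact_mod_cast (by omega : n ≠ 0)
  refine ⟨(n : ℝ)⁻¹ • 1, isSymm_one.smul _, PosSemidef.one.smul (by positivity), ?_⟩
  simp [trace_smul, hn']

theorem isLinearMap_Amap {n m : ℕ} (A : Fin m → Matrix (Fin n) (Fin n) ℝ) :
    IsLinearMap ℝ (Amap A) := by
  constructor <;> intros <;> ext i <;> simp [Amap, mul_add, trace_add]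

theorem convex_momentBody {n m : ℕ} (A : Fin m → Matrix (Fin n) (Fin n) ℝ) :
    Convex ℝ (momentBody A) :=
  (convex_spectraplex n).is_linear_image (isLinearMap_Amap A)

theorem trace_matA_mul {n m : ℕ} (A : Fin m → Matrix (Fin n) (Fin n) ℝ)
    (y : EuclideanSpace ℝ (Fin m)) (X : Matrix (Fin n) (Fin n) ℝ) :
    trace (matA A y * X) = ⟪Amap A X, y⟫ := by
  simp [matA, Amap, PiLp.inner_apply, Finset.sum_mul, trace_sum]

/-- The finite-dimensional supporting hyperplane theorem, for sets with possibly empty interior. -/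
theorem Convex.exists_ne_zero_forall_inner_le {E : Type*} [NormedAddCommGroup E]
    [InnerProductSpace ℝ E] [FiniteDimensional ℝ E] {s : Set E} (hs : Convex ℝ s)
    (hne : s.Nonempty) {b : E} (hb : b ∉ interior s) :
    ∃ y : E, y ≠ 0 ∧ ∀ z ∈ s, ⟪z, y⟫ ≤ ⟪b, y⟫ := by
  by_cases hint : (interior s).Nonempty
  · obtain ⟨f, hf, hfs⟩ := geometric_hahn_banach_of_nonempty_interior_point hs hb hint
    refine ⟨(InnerProductSpace.toDual ℝ E).symm f, by simpa using hf, fun z hz => ?_⟩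
    rw [real_inner_comm, real_inner_comm _ b, InnerProductSpace.toDual_symm_apply,
      InnerProductSpace.toDual_symm_apply]
    exact hfs z hz
  · rw [hs.interior_nonempty_iff_affineSpan_eq_top,
      ← AffineSubspace.direction_eq_top_iff_of_nonempty (hne.affineSpan ℝ),
      ← Submodule.orthogonal_eq_bot_iff] at hint
    obtain ⟨y, hy, hy0⟩ := Submodule.exists_mem_ne_zero_of_ne_bot hint
    obtain ⟨z₀, hz₀⟩ := hne
    have hconst (z) (hz : z ∈ s) : ⟪z, y⟫ = ⟪z₀, y⟫ := by
      have h := (Submodule.mem_orthogonal _ y).1 hy (z - z₀)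
        (AffineSubspace.vsub_mem_direction (subset_affineSpan ℝ s hz)
          (subset_affineSpan ℝ s hz₀))
      rwa [inner_sub_left, sub_eq_zero] at h
    rcases le_total ⟪z₀, y⟫ ⟪b, y⟫ with h | h
    · exact ⟨y, hy0, fun z hz => (hconst z hz).trans_le h⟩
    · refine ⟨-y, neg_ne_zero.2 hy0, fun z hz => ?_⟩
      rw [inner_neg_right, inner_neg_right, hconst z hz]
      exact neg_le_neg h

/-- f is coercive iff b lies in the interior of the moment body. -/
theorem stmt3 (n m : ℕ) (hn : 1 ≤ n)
    (A : Fin m → Matrix (Fin n) (Fin n) ℝ) (hA : ∀ i, (A i)ᵀ = A i)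
    (hind : LinearIndependent ℝ
      (Fin.cons (1 : Matrix (Fin n) (Fin n) ℝ) A : Fin (m + 1) → Matrix (Fin n) (Fin n) ℝ))
    (b : EuclideanSpace ℝ (Fin m)) :
    Filter.Tendsto (logPart A b) (Filter.cocompact (EuclideanSpace ℝ (Fin m))) Filter.atTop ↔
      b ∈ interior (momentBody A) := by
  constructor
  · intro hcoer
    by_contra hb
    obtain ⟨y, hy0, hy⟩ := (convex_momentBody A).exists_ne_zero_forall_inner_le
      ((spectraplex_nonempty hn).image _) hb
    have hbound (t : ℝ) (ht : 0 ≤ t) : logPart A b (t • y) ≤ Real.log n := by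
      have h := log_trace_exp_le_of_forall_trace_mul_le hn (isSymm_matA hA (t • y))
        (c := ⟪b, t • y⟫) fun X hX => by
          rw [trace_matA_mul, inner_smul_right, inner_smul_right]
          exact mul_le_mul_of_nonneg_left (hy _ ⟨X, hX, rfl⟩) ht
      rw [logPart]
      linarith
    have hray : Tendsto (fun t : ℝ => t • y) atTop (cocompact (EuclideanSpace ℝ (Fin m))) := by
      rw [← Metric.cobounded_eq_cocompact, ← tendsto_norm_atTop_iff_cobounded]
      simp only [norm_smul]
      exact tendsto_norm_atTop_atTop.atTop_mul_const (norm_pos_iff.2 hy0)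
    obtain ⟨t, ht, ht'⟩ := (((hcoer.comp hray).eventually_gt_atTop (Real.log n)).and
      (eventually_ge_atTop 0)).exists
    exact (hbound t ht').not_gt ht
  · intro hb
    obtain ⟨r, hr, hball⟩ := Metric.nhds_basis_closedBall.mem_iff.1 (mem_interior_iff_mem_nhds.1 hb)
    refine tendsto_atTop_mono (fun y => ?_)
      ((tendsto_norm_cocompact_atTop (E := EuclideanSpace ℝ (Fin m))).const_mul_atTop hr)
    have hmem : b + (r * ‖y‖⁻¹) • y ∈ momentBody A := by
      apply hball
      rw [mem_closedBall_iff_norm, add_sub_cancel_left, norm_smul, norm_mul, norm_inv, norm_norm,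
        Real.norm_of_nonneg hr.le, mul_assoc]
      exact mul_le_of_le_one_right hr.le (inv_mul_le_one)
    obtain ⟨X, hX, hXb⟩ := hmem
    have h := trace_mul_le_log_trace_exp (isSymm_matA hA y) hX
    rw [trace_matA_mul, hXb, inner_add_left, real_inner_smul_left,
      real_inner_self_eq_norm_mul_norm] at h
    have hnorm : r * ‖y‖⁻¹ * (‖y‖ * ‖y‖) = r * ‖y‖ := by
      rcases eq_or_ne ‖y‖ 0 with h0 | h0
      · simp [h0]
      · field_simp
    rw [logPart]
    linarith
end

section
/- Assume the matrices A_1, …, A_m are traceless and orthonormal: tr(A_i) = 0 and tr(A_i A_j) = δ_{ij}. Then the log-partition function f is (1/2)-smooth: its gradient map y ↦ ∇f(y) is Lipschitz continuous on ℝ^m with Lipschitz constant 1/2. -/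
open Matrix Filter
open scoped RealInnerProductSpace

/-- `B` and `X` are simultaneously diagonalized by an orthogonal matrix, the eigenvalues of `X`
being the exponentials of those of `B`. -/
def IsExpDiag {ι : Type*} [Fintype ι] [DecidableEq ι] (B X : Matrix ι ι ℝ) : Prop :=
  ∃ (U : Matrix ι ι ℝ) (v : ι → ℝ), Uᵀ * U = 1 ∧ B = U * diagonal v * Uᵀ ∧
    X = U * diagonal (fun i => Real.exp (v i)) * Uᵀ

theorem exp_sub_exp_le_of_le {x y : ℝ} (h : y ≤ x) :
    Real.exp x - Real.exp y ≤ (Real.exp x + Real.exp y) / 2 * (x - y) := by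
  have key : ∀ t : ℝ, 0 ≤ t → 0 ≤ (t - 2) * Real.exp t + t + 2 := by
    have hd : ∀ t : ℝ, HasDerivAt (fun t : ℝ => (t - 2) * Real.exp t + t + 2)
        ((t - 1) * Real.exp t + 1) t := by
      intro t
      have h1 := (((((hasDerivAt_id t).sub_const 2).mul (Real.hasDerivAt_exp t)).add
        (hasDerivAt_id t)).add_const 2)
      refine h1.congr_deriv ?_
      simp only [id]
      ring
    have hm : Monotone (fun t : ℝ => (t - 2) * Real.exp t + t + 2) := by
      refine monotone_of_deriv_nonneg (fun t => (hd t).differentiableAt) fun t => ?_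
      rw [(hd t).deriv]
      have h1 := Real.add_one_le_exp (-t)
      have h2 : Real.exp (-t) * Real.exp t = 1 := by rw [← Real.exp_add]; simp
      nlinarith [Real.exp_pos t]
    intro t ht
    have := hm ht
    simp only [Real.exp_zero] at this
    linarith
  have h1 := key (x - y) (by linarith)
  have h2 : Real.exp (x - y) * Real.exp y = Real.exp x := by rw [← Real.exp_add]; simp
  nlinarith [mul_nonneg h1 (Real.exp_pos y).le]

theorem sq_exp_sub_exp_le (x y : ℝ) :
    (Real.exp x - Real.exp y) ^ 2 ≤ ((Real.exp x + Real.exp y) / 2) ^ 2 * (x - y) ^ 2 := by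
  rw [← mul_pow]
  rcases le_total y x with h | h
  · exact pow_le_pow_left₀ (sub_nonneg.2 (Real.exp_le_exp.2 h)) (exp_sub_exp_le_of_le h) 2
  · have := pow_le_pow_left₀ (sub_nonneg.2 (Real.exp_le_exp.2 h)) (exp_sub_exp_le_of_le h) 2
    calc _ = (Real.exp y - Real.exp x) ^ 2 := by ring
      _ ≤ _ := this
      _ = _ := by ring

/-- Popoviciu-type bound of the variance by half of the sum of squares. -/
theorem variance_le_half_sum_sq {ι : Type*} [Fintype ι] {p : ι → ℝ}
    (hp : ∀ i, 0 ≤ p i) (hp1 : ∑ i, p i = 1) (w : ι → ℝ) :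
    ∑ i, p i * w i ^ 2 - (∑ i, p i * w i) ^ 2 ≤ 1 / 2 * ∑ i, w i ^ 2 := by
  classical
  have hsq : ∀ i j, p i * p j * (w i - w j) ^ 2 ≤
      2 * (p i * p j * (w i ^ 2 + w j ^ 2)) - (if i = j then 4 * (p i ^ 2 * w i ^ 2) else 0) := by
    intro i j
    split_ifs with h
    · subst h
      nlinarith
    · nlinarith [mul_nonneg (mul_nonneg (hp i) (hp j)) (sq_nonneg (w i + w j))]
  have hsum := Finset.sum_le_sum fun i (_ : i ∈ Finset.univ) =>
    Finset.sum_le_sum fun j (_ : j ∈ Finset.univ) => hsq i j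
  have e1 : ∑ i, ∑ j, p i * p j * w i ^ 2 = ∑ i, p i * w i ^ 2 := by
    refine Finset.sum_congr rfl fun i _ => ?_
    rw [← Finset.sum_mul, ← Finset.mul_sum, hp1, mul_one]
  have e2 : ∑ i, ∑ j, p i * p j * w j ^ 2 = ∑ i, p i * w i ^ 2 := by
    rw [Finset.sum_comm, ← e1]
    exact Finset.sum_congr rfl fun i _ => Finset.sum_congr rfl fun j _ => by ring
  have e3 : ∑ i, ∑ j, p i * p j * (w i * w j) = (∑ i, p i * w i) ^ 2 := by
    rw [sq, Finset.sum_mul_sum]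
    exact Finset.sum_congr rfl fun i _ => Finset.sum_congr rfl fun j _ => by ring
  have l : ∑ i, ∑ j, p i * p j * (w i - w j) ^ 2 =
      2 * ∑ i, p i * w i ^ 2 - 2 * (∑ i, p i * w i) ^ 2 := by
    rw [← e3, two_mul]
    nth_rewrite 1 [← e1]
    rw [← e2]
    simp only [Finset.mul_sum, ← Finset.sum_add_distrib, ← Finset.sum_sub_distrib]
    exact Finset.sum_congr rfl fun i _ => Finset.sum_congr rfl fun j _ => by ring
  have r : ∑ i, ∑ j, (2 * (p i * p j * (w i ^ 2 + w j ^ 2)) -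
      (if i = j then 4 * (p i ^ 2 * w i ^ 2) else 0)) =
      4 * ∑ i, p i * w i ^ 2 - 4 * ∑ i, p i ^ 2 * w i ^ 2 := by
    have : ∑ i, ∑ j, p i * p j * (w i ^ 2 + w j ^ 2) = 2 * ∑ i, p i * w i ^ 2 := by
      simp only [mul_add, Finset.sum_add_distrib, e1, e2]
      ring
    simp only [Finset.sum_sub_distrib, Finset.sum_ite_eq, Finset.mem_univ, if_true,
      ← Finset.mul_sum, this]
    ring
  rw [l, r] at hsum
  have hq : 4 * ∑ i, p i * w i ^ 2 - 4 * ∑ i, p i ^ 2 * w i ^ 2 ≤ ∑ i, w i ^ 2 := by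
    rw [← mul_sub, ← Finset.sum_sub_distrib, Finset.mul_sum]
    refine Finset.sum_le_sum fun i _ => ?_
    nlinarith [mul_nonneg (sq_nonneg (2 * p i - 1)) (sq_nonneg (w i))]
  linarith

section Matrices

variable {ι : Type*} [Fintype ι]

theorem sum_mul_eq_trace_mul_transpose (M N : Matrix ι ι ℝ) :
    ∑ i, ∑ j, M i j * N i j = (M * Nᵀ).trace := by
  simp [Matrix.trace, Matrix.mul_apply]

variable [DecidableEq ι]

theorem sum_conj_mul_conj {U V : Matrix ι ι ℝ} (hU : U * Uᵀ = 1) (hV : V * Vᵀ = 1)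
    (P W : Matrix ι ι ℝ) :
    ∑ i, ∑ j, (Uᵀ * P * V) i j * (Uᵀ * W * V) i j = (P * Wᵀ).trace := by
  rw [sum_mul_eq_trace_mul_transpose]
  calc (Uᵀ * P * V * (Uᵀ * W * V)ᵀ).trace = (Uᵀ * (P * (V * Vᵀ) * Wᵀ * U)).trace := by
        simp only [Matrix.transpose_mul, Matrix.transpose_transpose, Matrix.mul_assoc]
    _ = (P * Wᵀ * (U * Uᵀ)).trace := by
        rw [Matrix.trace_mul_comm, hV, Matrix.mul_one, Matrix.mul_assoc]
    _ = _ := by rw [hU, Matrix.mul_one]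

theorem sum_left_weight_conj_sq {U V : Matrix ι ι ℝ} (hU : U * Uᵀ = 1) (hV : V * Vᵀ = 1)
    (a : ι → ℝ) {W : Matrix ι ι ℝ} (hW : Wᵀ = W) :
    ∑ i, ∑ j, a i * (Uᵀ * W * V) i j ^ 2 = (U * diagonal a * Uᵀ * (W * W)).trace := by
  have h := sum_conj_mul_conj hU hV (U * diagonal a * Uᵀ * W) W
  rw [hW, Matrix.mul_assoc _ W W] at h
  rw [← h]
  have e : Uᵀ * (U * diagonal a * Uᵀ * W) * V = diagonal a * (Uᵀ * W * V) := by
    simp only [← Matrix.mul_assoc, mul_eq_one_comm.1 hU, Matrix.one_mul]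
  rw [e]
  refine Finset.sum_congr rfl fun i _ => Finset.sum_congr rfl fun j _ => ?_
  rw [Matrix.diagonal_mul]
  ring

theorem sum_right_weight_conj_sq {U V : Matrix ι ι ℝ} (hU : U * Uᵀ = 1) (hV : V * Vᵀ = 1)
    (a : ι → ℝ) {W : Matrix ι ι ℝ} (hW : Wᵀ = W) :
    ∑ i, ∑ j, a j * (Uᵀ * W * V) i j ^ 2 = (V * diagonal a * Vᵀ * (W * W)).trace := by
  rw [← sum_left_weight_conj_sq hV hU a hW, Finset.sum_comm]
  refine Finset.sum_congr rfl fun i _ => Finset.sum_congr rfl fun j _ => ?_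
  have : Vᵀ * W * U = (Uᵀ * W * V)ᵀ := by
    simp only [Matrix.transpose_mul, Matrix.transpose_transpose, hW, Matrix.mul_assoc]
  rw [this, Matrix.transpose_apply]

theorem conj_sub_apply {U V : Matrix ι ι ℝ} (hU : U * Uᵀ = 1) (hV : V * Vᵀ = 1)
    (a b : ι → ℝ) (i j : ι) :
    (Uᵀ * (U * diagonal a * Uᵀ - V * diagonal b * Vᵀ) * V) i j =
      (a i - b j) * (Uᵀ * V) i j := by
  have e : Uᵀ * (U * diagonal a * Uᵀ - V * diagonal b * Vᵀ) * V =
      diagonal a * (Uᵀ * V) - Uᵀ * V * diagonal b := by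
    have h1 : Uᵀ * (U * diagonal a * Uᵀ) * V = diagonal a * (Uᵀ * V) := by
      simp only [← Matrix.mul_assoc, mul_eq_one_comm.1 hU, Matrix.one_mul]
    have h2 : Uᵀ * (V * diagonal b * Vᵀ) * V = Uᵀ * V * diagonal b := by
      simp only [Matrix.mul_assoc, mul_eq_one_comm.1 hV, Matrix.mul_one]
    rw [Matrix.mul_sub, Matrix.sub_mul, h1, h2]
  rw [e, Matrix.sub_apply, Matrix.diagonal_mul, Matrix.mul_diagonal]
  ring

theorem transpose_conj_diagonal (U : Matrix ι ι ℝ) (a : ι → ℝ) :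
    (U * diagonal a * Uᵀ)ᵀ = U * diagonal a * Uᵀ := by
  simp only [Matrix.transpose_mul, Matrix.transpose_transpose, Matrix.diagonal_transpose,
    Matrix.mul_assoc]

theorem exists_orthogonal_diagonalization {W : Matrix ι ι ℝ} (hW : Wᵀ = W) :
    ∃ (U : Matrix ι ι ℝ) (v : ι → ℝ), U * Uᵀ = 1 ∧ W = U * diagonal v * Uᵀ := by
  have hH : W.IsHermitian := by
    rw [Matrix.IsHermitian, Matrix.conjTranspose_eq_transpose_of_trivial, hW]
  refine ⟨hH.eigenvectorUnitary, hH.eigenvalues, ?_, ?_⟩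
  · have := Unitary.mul_star_self_of_mem hH.eigenvectorUnitary.2
    rwa [Matrix.star_eq_conjTranspose, Matrix.conjTranspose_eq_transpose_of_trivial] at this
  · have := hH.spectral_theorem
    rw [Unitary.conjStarAlgAut_apply, Matrix.star_eq_conjTranspose,
      Matrix.conjTranspose_eq_transpose_of_trivial] at this
    exact this

theorem IsExpDiag.posSemidef {B X : Matrix ι ι ℝ} (h : IsExpDiag B X) : X.PosSemidef := by
  obtain ⟨U, v, -, -, rfl⟩ := h
  rw [← Matrix.conjTranspose_eq_transpose_of_trivial]
  exact (Matrix.PosSemidef.diagonal fun i => (Real.exp_pos _).le).mul_mul_conjTranspose_same U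

theorem isExpDiag_exp {S : Matrix ι ι ℝ} (hS : Sᵀ = S) : IsExpDiag S (NormedSpace.exp S) := by
  obtain ⟨U, v, hU, hSv⟩ := exists_orthogonal_diagonalization hS
  refine ⟨U, v, mul_eq_one_comm.1 hU, hSv, ?_⟩
  have hinv : U⁻¹ = Uᵀ := Matrix.inv_eq_right_inv hU
  rw [hSv, ← hinv, Matrix.exp_conj _ _ (IsUnit.of_mul_eq_one _ hU), Matrix.exp_diagonal]
  congr 3
  funext i
  rw [Pi.coe_exp, Real.exp_eq_exp_ℝ]

theorem IsExpDiag.shift {B X : Matrix ι ι ℝ} (h : IsExpDiag B X) {z : ℝ} (hz : 0 < z) :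
    IsExpDiag (B - Real.log z • (1 : Matrix ι ι ℝ)) (z⁻¹ • X) := by
  obtain ⟨U, v, hU, rfl, rfl⟩ := h
  refine ⟨U, fun i => v i - Real.log z, hU, ?_, ?_⟩
  · have : diagonal (fun i => v i - Real.log z) =
        diagonal v - Real.log z • (1 : Matrix ι ι ℝ) := by
      rw [Matrix.smul_one_eq_diagonal, Matrix.diagonal_sub]
    rw [this, Matrix.mul_sub, Matrix.sub_mul, Matrix.mul_smul, Matrix.mul_one, Matrix.smul_mul,
      mul_eq_one_comm.1 hU]
  · have : diagonal (fun i => Real.exp (v i - Real.log z)) =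
        z⁻¹ • diagonal (fun i => Real.exp (v i)) := by
      rw [← Matrix.diagonal_smul]
      congr 1
      funext i
      rw [Real.exp_sub, Real.exp_log hz, Pi.smul_apply, smul_eq_mul, div_eq_inv_mul]
    rw [this, Matrix.mul_smul, Matrix.smul_mul]

theorem IsExpDiag.trace_pos [Nonempty ι] {B X : Matrix ι ι ℝ} (h : IsExpDiag B X) :
    0 < X.trace := by
  obtain ⟨U, v, hU, -, rfl⟩ := h
  rw [Matrix.trace_mul_comm, ← Matrix.mul_assoc, hU, Matrix.one_mul, Matrix.trace_diagonal]
  exact Finset.sum_pos (fun i _ => Real.exp_pos _) Finset.univ_nonempty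

/-- Klein's inequality for the exponential. -/
theorem IsExpDiag.trace_mul_sub_le {B X B' X' : Matrix ι ι ℝ} (h : IsExpDiag B X)
    (h' : IsExpDiag B' X') : (X * (B' - B)).trace ≤ X'.trace - X.trace := by
  obtain ⟨U, v, hU, rfl, rfl⟩ := h
  obtain ⟨V, w, hV, rfl, rfl⟩ := h'
  replace hU := mul_eq_one_comm.1 hU
  replace hV := mul_eq_one_comm.1 hV
  set X := U * diagonal (fun i => Real.exp (v i)) * Uᵀ with hX
  set B := U * diagonal v * Uᵀ with hB
  set B' := V * diagonal w * Vᵀ with hB'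
  have hsym : (B - B')ᵀ = B - B' := by
    rw [Matrix.transpose_sub, transpose_conj_diagonal, transpose_conj_diagonal]
  have h1 := sum_conj_mul_conj hU hV X (B - B')
  have h2 := sum_conj_mul_conj hU hV (X - V * diagonal (fun i => Real.exp (w i)) * Vᵀ) 1
  rw [hsym] at h1
  rw [Matrix.transpose_one, Matrix.mul_one (X - _), Matrix.trace_sub] at h2
  rw [← neg_sub B B', Matrix.mul_neg, Matrix.trace_neg, ← neg_sub X.trace, ← h1, ← h2,
    neg_le_neg_iff]
  have hXV : Uᵀ * X * V = diagonal (fun i => Real.exp (v i)) * (Uᵀ * V) := by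
    simp only [hX, ← Matrix.mul_assoc, mul_eq_one_comm.1 hU, Matrix.one_mul]
  refine Finset.sum_le_sum fun i _ => Finset.sum_le_sum fun j _ => ?_
  rw [hX, hB, hB', conj_sub_apply hU hV, conj_sub_apply hU hV, ← hX, hXV, Matrix.diagonal_mul,
    Matrix.mul_one]
  have h3 : Real.exp (v i) * (w j - v i + 1) ≤ Real.exp (w j) := by
    calc _ ≤ Real.exp (v i) * Real.exp (w j - v i) :=
          mul_le_mul_of_nonneg_left (Real.add_one_le_exp _) (Real.exp_pos _).le
      _ = _ := by rw [← Real.exp_add]; congr 1; ring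
  nlinarith [mul_le_mul_of_nonneg_left h3 (sq_nonneg ((Uᵀ * V) i j))]

theorem IsExpDiag.sq_trace_sub_mul_le {B X B' X' : Matrix ι ι ℝ} (h : IsExpDiag B X)
    (h' : IsExpDiag B' X') {W : Matrix ι ι ℝ} (hW : Wᵀ = W) :
    ((X - X') * W).trace ^ 2 ≤
      (((1 / 2 : ℝ) • (X + X')) * ((B - B') * (B - B'))).trace *
        (((1 / 2 : ℝ) • (X + X')) * (W * W)).trace := by
  obtain ⟨U, v, hU, rfl, rfl⟩ := h
  obtain ⟨V, w, hV, rfl, rfl⟩ := h'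
  replace hU := mul_eq_one_comm.1 hU
  replace hV := mul_eq_one_comm.1 hV
  have hweight : ∀ {Y : Matrix ι ι ℝ}, Yᵀ = Y →
      (((1 / 2 : ℝ) • (U * diagonal (fun i => Real.exp (v i)) * Uᵀ +
        V * diagonal (fun i => Real.exp (w i)) * Vᵀ)) * (Y * Y)).trace =
      ∑ q : ι × ι, (Real.exp (v q.1) + Real.exp (w q.2)) / 2 * (Uᵀ * Y * V) q.1 q.2 ^ 2 := by
    intro Y hY
    rw [Matrix.smul_mul, Matrix.trace_smul, Matrix.add_mul, Matrix.trace_add,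
      ← sum_left_weight_conj_sq hU hV _ hY, ← sum_right_weight_conj_sq hU hV _ hY,
      Fintype.sum_prod_type]
    simp only [smul_eq_mul, ← Finset.sum_add_distrib, Finset.mul_sum]
    exact Finset.sum_congr rfl fun i _ => Finset.sum_congr rfl fun j _ => by ring
  have hsym : (U * diagonal v * Uᵀ - V * diagonal w * Vᵀ)ᵀ =
      U * diagonal v * Uᵀ - V * diagonal w * Vᵀ := by
    rw [Matrix.transpose_sub, transpose_conj_diagonal, transpose_conj_diagonal]
  rw [hweight hsym, hweight hW]
  nth_rewrite 1 [← hW]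
  rw [← sum_conj_mul_conj hU hV, ← Fintype.sum_prod_type']
  refine Finset.sum_sq_le_sum_mul_sum_of_sq_le_mul _ (fun q _ => by positivity)
    (fun q _ => by positivity) fun q _ => ?_
  rw [conj_sub_apply hU hV, conj_sub_apply hU hV]
  have := mul_le_mul_of_nonneg_right (sq_exp_sub_exp_le (v q.1) (w q.2))
    (mul_nonneg (sq_nonneg ((Uᵀ * V) q.1 q.2)) (sq_nonneg ((Uᵀ * W * V) q.1 q.2)))
  nlinarith

theorem trace_mul_sq_sub_sq_trace_le {M : Matrix ι ι ℝ} (hM : M.PosSemidef) (hM1 : M.trace = 1)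
    {W : Matrix ι ι ℝ} (hW : Wᵀ = W) :
    (M * (W * W)).trace - (M * W).trace ^ 2 ≤ 1 / 2 * (W * W).trace := by
  obtain ⟨U, w, hU, rfl⟩ := exists_orthogonal_diagonalization hW
  have hU' := mul_eq_one_comm.1 hU
  have hp : (Uᵀ * M * U).PosSemidef := by
    simpa [Matrix.conjTranspose_eq_transpose_of_trivial] using hM.conjTranspose_mul_mul_same U
  have hWW : U * diagonal w * Uᵀ * (U * diagonal w * Uᵀ) =
      U * diagonal (fun i => w i ^ 2) * Uᵀ := by
    calc _ = U * diagonal w * (Uᵀ * U) * diagonal w * Uᵀ := by simp only [Matrix.mul_assoc]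
      _ = _ := by
        rw [hU', Matrix.mul_one, Matrix.mul_assoc U, Matrix.diagonal_mul_diagonal]
        simp only [sq]
  have htr : ∀ a : ι → ℝ, (M * (U * diagonal a * Uᵀ)).trace =
      ∑ i, (Uᵀ * M * U) i i * a i := by
    intro a
    rw [← Matrix.mul_assoc, Matrix.trace_mul_comm, ← Matrix.mul_assoc, ← Matrix.mul_assoc]
    simp [Matrix.trace, Matrix.mul_diagonal]
  have hp1 : ∑ i, (Uᵀ * M * U) i i = 1 := by
    have := htr fun _ => 1
    rw [Matrix.diagonal_one, Matrix.mul_one, hU, Matrix.mul_one, hM1] at this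
    simpa using this.symm
  have htr' : (U * diagonal (fun i => w i ^ 2) * Uᵀ).trace = ∑ i, w i ^ 2 := by
    rw [Matrix.trace_mul_comm, ← Matrix.mul_assoc, hU', Matrix.one_mul, Matrix.trace_diagonal]
  rw [hWW, htr, htr, htr']
  exact variance_le_half_sum_sq (fun i => hp.diag_nonneg) hp1 w

theorem trace_mul_shift_sq {M : Matrix ι ι ℝ} (hM1 : M.trace = 1) (W : Matrix ι ι ℝ) (c : ℝ) :
    (M * ((W - c • 1) * (W - c • 1))).trace =
      (M * (W * W)).trace - (M * W).trace ^ 2 + ((M * W).trace - c) ^ 2 := by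
  have : (W - c • (1 : Matrix ι ι ℝ)) * (W - c • 1) = W * W - (2 * c) • W + c ^ 2 • 1 := by
    simp only [Matrix.mul_sub, Matrix.sub_mul, Matrix.smul_mul, Matrix.mul_smul, Matrix.mul_one,
      Matrix.one_mul]
    module
  rw [this, Matrix.mul_add, Matrix.mul_sub, Matrix.trace_add, Matrix.trace_sub, Matrix.mul_smul,
    Matrix.mul_smul, Matrix.trace_smul, Matrix.trace_smul, Matrix.mul_one, hM1]
  simp only [smul_eq_mul]
  ring

/-- Gibbs' inequality for normalized exponentials. -/
theorem trace_mul_sub_le_of_shift {S S' X X' : Matrix ι ι ℝ} {z z' : ℝ}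
    (h : IsExpDiag (S - z • 1) X) (h' : IsExpDiag (S' - z' • 1) X')
    (hX : X.trace = 1) (hX' : X'.trace = 1) : (X * (S' - S)).trace ≤ z' - z := by
  have h1 := h.trace_mul_sub_le h'
  have e : S' - z' • (1 : Matrix ι ι ℝ) - (S - z • 1) = S' - S - (z' - z) • 1 := by module
  rw [e, Matrix.mul_sub, Matrix.trace_sub, Matrix.mul_smul, Matrix.trace_smul, Matrix.mul_one,
    hX, hX', smul_eq_mul] at h1
  linarith

theorem sq_trace_sub_mul_le_of_shift {S S' X X' : Matrix ι ι ℝ} {z z' : ℝ}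
    (hS : Sᵀ = S) (hS' : S'ᵀ = S')
    (h : IsExpDiag (S - z • 1) X) (h' : IsExpDiag (S' - z' • 1) X')
    (hX : X.trace = 1) (hX' : X'.trace = 1) {W : Matrix ι ι ℝ} (hW : Wᵀ = W) :
    ((X - X') * W).trace ^ 2 ≤
      (1 / 2 * ((S - S') * (S - S')).trace + (((X - X') * (S - S')).trace / 2) ^ 2) *
        (1 / 2 * (W * W).trace) := by
  set M := (1 / 2 : ℝ) • (X + X') with hM
  have hMpsd : M.PosSemidef := (h.posSemidef.add h'.posSemidef).smul (by norm_num)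
  have hM1 : M.trace = 1 := by
    rw [hM, Matrix.trace_smul, Matrix.trace_add, hX, hX', smul_eq_mul]; norm_num
  set c := (M * W).trace with hc
  have hWc : (W - c • (1 : Matrix ι ι ℝ))ᵀ = W - c • 1 := by
    rw [Matrix.transpose_sub, Matrix.transpose_smul, Matrix.transpose_one, hW]
  have h1 := h.sq_trace_sub_mul_le h' hWc
  have e : S - z • (1 : Matrix ι ι ℝ) - (S' - z' • 1) = S - S' - (z - z') • 1 := by module
  have e2 : ((X - X') * (W - c • 1)).trace = ((X - X') * W).trace := by
    rw [Matrix.mul_sub, Matrix.trace_sub, Matrix.mul_smul, Matrix.trace_smul, Matrix.mul_one,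
      Matrix.trace_sub X, hX, hX']
    simp
  have hSS : (S - S')ᵀ = S - S' := by rw [Matrix.transpose_sub, hS, hS']
  have v1 := trace_mul_sq_sub_sq_trace_le hMpsd hM1 hSS
  have v2 := trace_mul_sq_sub_sq_trace_le hMpsd hM1 hW
  rw [e, e2, ← hM, trace_mul_shift_sq hM1, trace_mul_shift_sq hM1, ← hc, sub_self] at h1
  rw [← hc] at v2
  have g1 := trace_mul_sub_le_of_shift h h' hX hX'
  have g2 := trace_mul_sub_le_of_shift h' h hX' hX
  rw [← neg_sub S S', Matrix.mul_neg, Matrix.trace_neg] at g1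
  have hMS : (M * (S - S')).trace =
      ((X * (S - S')).trace + (X' * (S - S')).trace) / 2 := by
    rw [hM, Matrix.smul_mul, Matrix.trace_smul, Matrix.add_mul, Matrix.trace_add, smul_eq_mul]
    ring
  have hmid : ((M * (S - S')).trace - (z - z')) ^ 2 ≤
      (((X - X') * (S - S')).trace / 2) ^ 2 := by
    rw [hMS, Matrix.sub_mul X, Matrix.trace_sub]
    apply sq_le_sq'
    · linarith
    · linarith
  refine h1.trans (mul_le_mul (by linarith) (by linarith) ?_ ?_)
  · rw [zero_pow two_ne_zero, add_zero]
    have := trace_mul_shift_sq hM1 W c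
    rw [← hc, sub_self, zero_pow two_ne_zero, add_zero] at this
    have hnonneg := (hMpsd.mul_mul_conjTranspose_same (W - c • (1 : Matrix ι ι ℝ))).trace_nonneg
    rw [Matrix.conjTranspose_eq_transpose_of_trivial, hWc, Matrix.mul_assoc,
      Matrix.trace_mul_comm, Matrix.mul_assoc, this] at hnonneg
    exact hnonneg
  · have : 0 ≤ ((S - S') * (S - S')).trace := by
      nth_rewrite 2 [← hSS]
      rw [← sum_mul_eq_trace_mul_transpose]
      exact Finset.sum_nonneg fun i _ => Finset.sum_nonneg fun j _ => mul_self_nonneg _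
    positivity

end Matrices

/-- A map with a local Lipschitz estimate that is asymptotically sharp at small scales is
globally Lipschitz, by subdividing segments. -/
theorem lipschitzWith_half_of_local {E F : Type*} [NormedAddCommGroup E] [NormedSpace ℝ E]
    [NormedAddCommGroup F] {φ : E → F}
    (h : ∀ x y, ‖φ x - φ y‖ ^ 2 * (1 - ‖x - y‖ ^ 2 / 8) ≤ ‖x - y‖ ^ 2 / 4) :
    LipschitzWith (1 / 2) φ := by
  refine LipschitzWith.of_dist_le_mul fun x y => ?_
  set d := dist x y with hd
  have hd0 : 0 ≤ d := dist_nonneg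
  set N := dist (φ x) (φ y) with hN
  have hlim : Tendsto (fun k : ℕ => N ^ 2 * (1 - (d / k) ^ 2 / 8)) atTop
      (nhds (N ^ 2 * (1 - 0 ^ 2 / 8))) :=
    (((tendsto_const_div_atTop_nhds_zero_nat d).pow 2).div_const 8).const_sub 1 |>.const_mul _
  have hN2 : N ^ 2 * (1 - 0 ^ 2 / 8) ≤ d ^ 2 / 4 := by
    refine le_of_tendsto hlim ?_
    filter_upwards [eventually_gt_atTop 0, (tendsto_const_div_atTop_nhds_zero_nat d).eventually
      (gt_mem_nhds one_pos)] with k hk hk1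
    have hk0 : (0 : ℝ) < k := by exact_mod_cast hk
    have hr0 : 0 ≤ d / k := by positivity
    have hpos : 0 < 1 - (d / k) ^ 2 / 8 := by nlinarith
    set p : ℕ → E := fun i => x + ((i : ℝ) / k) • (y - x) with hp
    have hstep : ∀ i, dist (φ (p i)) (φ (p (i + 1))) ≤
        Real.sqrt ((d / k) ^ 2 / 4 / (1 - (d / k) ^ 2 / 8)) := by
      intro i
      have hpp : ‖p i - p (i + 1)‖ = d / k := by
        have : p i - p (i + 1) = (1 / (k : ℝ)) • (x - y) := by
          simp only [hp]
          push_cast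
          rw [add_div]
          module
        rw [this, norm_smul, hd, dist_eq_norm, Real.norm_of_nonneg (by positivity)]
        ring
      refine Real.le_sqrt_of_sq_le ?_
      rw [le_div_iff₀ hpos, dist_eq_norm]
      simpa only [hpp] using h (p i) (p (i + 1))
    have hsum := dist_le_range_sum_of_dist_le (f := fun i => φ (p i)) k
      (fun {i} _ => hstep i)
    have hpk : p k = y := by
      simp only [hp, div_self hk0.ne', one_smul, add_sub_cancel]
    have hp0 : p 0 = x := by simp [hp]
    simp only [hpk, hp0, Finset.sum_const, Finset.card_range, nsmul_eq_mul] at hsum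
    have hsq := pow_le_pow_left₀ dist_nonneg hsum 2
    rw [mul_pow, Real.sq_sqrt (by positivity), ← hN, ← mul_div_assoc, le_div_iff₀ hpos] at hsq
    calc _ ≤ _ := hsq
      _ = _ := by field_simp
  have : N ≤ d / 2 := by
    refine le_of_sq_le_sq ?_ (by positivity)
    nlinarith
  calc N ≤ d / 2 := this
    _ = _ := by push_cast; ring

section LogPartition

variable {n m : ℕ} {A : Fin m → Matrix (Fin n) (Fin n) ℝ}

theorem transpose_matA (hA : ∀ i, (A i)ᵀ = A i) (y : EuclideanSpace ℝ (Fin m)) :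
    (matA A y)ᵀ = matA A y := by
  simp [matA, Matrix.transpose_sum, hA]

theorem matA_sub (x y : EuclideanSpace ℝ (Fin m)) : matA A (x - y) = matA A x - matA A y := by
  simp [matA, sub_smul, Finset.sum_sub_distrib]

theorem inner_Amap (X : Matrix (Fin n) (Fin n) ℝ) (y : EuclideanSpace ℝ (Fin m)) :
    ⟪Amap A X, y⟫ = (X * matA A y).trace := by
  simp only [Amap, matA, PiLp.inner_apply, Matrix.mul_sum, Matrix.trace_sum, Matrix.mul_smul,
    Matrix.trace_smul, smul_eq_mul]
  refine Finset.sum_congr rfl fun i _ => ?_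
  rw [Matrix.trace_mul_comm X]
  simp

theorem Amap_sub (X Y : Matrix (Fin n) (Fin n) ℝ) : Amap A (X - Y) = Amap A X - Amap A Y := by
  ext i
  simp [Amap, Matrix.mul_sub]

theorem trace_matA_mul_self
    (horth : ∀ i j, Matrix.trace (A i * A j) = (1 : Matrix (Fin m) (Fin m) ℝ) i j)
    (y : EuclideanSpace ℝ (Fin m)) : (matA A y * matA A y).trace = ‖y‖ ^ 2 := by
  rw [← inner_Amap, ← real_inner_self_eq_norm_sq]
  congr 1
  ext i
  simp [Amap, matA, Matrix.mul_sum, Matrix.trace_sum, horth, Matrix.one_apply]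

variable [NeZero n]

theorem trace_exp_matA_pos (hA : ∀ i, (A i)ᵀ = A i) (y : EuclideanSpace ℝ (Fin m)) :
    0 < (NormedSpace.exp (matA A y)).trace :=
  (isExpDiag_exp (transpose_matA hA y)).trace_pos

theorem isExpDiag_densityMat (hA : ∀ i, (A i)ᵀ = A i) (y : EuclideanSpace ℝ (Fin m)) :
    IsExpDiag (matA A y - Real.log (NormedSpace.exp (matA A y)).trace • 1) (densityMat A y) :=
  (isExpDiag_exp (transpose_matA hA y)).shift (trace_exp_matA_pos hA y)

theorem trace_densityMat (hA : ∀ i, (A i)ᵀ = A i) (y : EuclideanSpace ℝ (Fin m)) :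
    (densityMat A y).trace = 1 := by
  rw [densityMat, Matrix.trace_smul, smul_eq_mul, inv_mul_cancel₀ (trace_exp_matA_pos hA y).ne']

theorem norm_sq_Amap_densityMat_sub_le (hA : ∀ i, (A i)ᵀ = A i)
    (horth : ∀ i j, Matrix.trace (A i * A j) = (1 : Matrix (Fin m) (Fin m) ℝ) i j)
    (x y : EuclideanSpace ℝ (Fin m)) :
    ‖Amap A (densityMat A x) - Amap A (densityMat A y)‖ ^ 2 * (1 - ‖x - y‖ ^ 2 / 8) ≤
      ‖x - y‖ ^ 2 / 4 := by
  set w := Amap A (densityMat A x) - Amap A (densityMat A y) with hw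
  have h := sq_trace_sub_mul_le_of_shift (transpose_matA hA x) (transpose_matA hA y)
    (isExpDiag_densityMat hA x) (isExpDiag_densityMat hA y) (trace_densityMat hA x)
    (trace_densityMat hA y) (transpose_matA hA w)
  rw [← matA_sub, trace_matA_mul_self horth, trace_matA_mul_self horth, ← inner_Amap,
    ← inner_Amap, Amap_sub, ← hw, real_inner_self_eq_norm_sq] at h
  have hcs : ⟪w, x - y⟫ ^ 2 ≤ ‖w‖ ^ 2 * ‖x - y‖ ^ 2 := by
    rw [← mul_pow, ← sq_abs]
    exact pow_le_pow_left₀ (abs_nonneg _) (abs_real_inner_le_norm _ _) 2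
  rcases (sq_nonneg ‖w‖).eq_or_lt with h0 | h0
  · rw [← h0, zero_mul]
    positivity
  · have h1 : ‖w‖ ^ 2 * ‖w‖ ^ 2 ≤
        (1 / 4 * ‖x - y‖ ^ 2 + ‖w‖ ^ 2 * ‖x - y‖ ^ 2 / 8) * ‖w‖ ^ 2 := by
      nlinarith [mul_le_mul_of_nonneg_right hcs h0.le]
    have h2 := le_of_mul_le_mul_right h1 h0
    linarith

theorem hasGradientAt_logPart (hA : ∀ i, (A i)ᵀ = A i)
    (horth : ∀ i j, Matrix.trace (A i * A j) = (1 : Matrix (Fin m) (Fin m) ℝ) i j)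
    (b y : EuclideanSpace ℝ (Fin m)) :
    HasGradientAt (logPart A b) (Amap A (densityMat A y) - b) y := by
  have hlip := lipschitzWith_half_of_local (norm_sq_Amap_densityMat_sub_le hA horth)
  rw [hasGradientAt_iff_isLittleO]
  refine Asymptotics.IsBigO.trans_isLittleO (g := fun x => ‖x - y‖ ^ 2) ?_ ?_
  · refine Asymptotics.IsBigO.of_bound 1 (Eventually.of_forall fun x => ?_)
    have g1 := trace_mul_sub_le_of_shift (isExpDiag_densityMat hA y) (isExpDiag_densityMat hA x)
      (trace_densityMat hA y) (trace_densityMat hA x)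
    have g2 := trace_mul_sub_le_of_shift (isExpDiag_densityMat hA x) (isExpDiag_densityMat hA y)
      (trace_densityMat hA x) (trace_densityMat hA y)
    rw [← matA_sub, ← inner_Amap] at g1 g2
    rw [← neg_sub x y, inner_neg_right] at g2
    have hl : ⟪Amap A (densityMat A x) - Amap A (densityMat A y), x - y⟫ ≤ ‖x - y‖ ^ 2 := by
      refine (real_inner_le_norm _ _).trans ?_
      have := hlip.dist_le_mul x y
      rw [dist_eq_norm, dist_eq_norm] at this
      push_cast at this
      nlinarith [norm_nonneg (x - y)]
    rw [inner_sub_left] at hl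
    rw [Real.norm_eq_abs, norm_pow, norm_norm, one_mul, abs_le]
    simp only [logPart, inner_sub_left]
    have hb : ⟪b, x - y⟫ = ⟪b, x⟫ - ⟪b, y⟫ := inner_sub_right _ _ _
    constructor <;> nlinarith [sq_nonneg ‖x - y‖]
  · exact (Asymptotics.isLittleO_pow_sub_sub y one_lt_two)

end LogPartition

/-- after normalization, f is (1/2)-smooth. -/
theorem stmt14 (n m : ℕ) (hn : 1 ≤ n)
    (A : Fin m → Matrix (Fin n) (Fin n) ℝ) (hA : ∀ i, (A i)ᵀ = A i)
    (htr : ∀ i, (A i).trace = 0)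
    (horth : ∀ i j, Matrix.trace (A i * A j) = (1 : Matrix (Fin m) (Fin m) ℝ) i j)
    (b : EuclideanSpace ℝ (Fin m)) :
    LipschitzWith (1 / 2) (gradient (logPart A b)) := by
  have : NeZero n := ⟨by omega⟩
  have hgrad : gradient (logPart A b) = fun y => Amap A (densityMat A y) - b :=
    funext fun y => (hasGradientAt_logPart hA horth b y).gradient
  rw [hgrad]
  refine lipschitzWith_half_of_local fun x y => ?_
  rw [sub_sub_sub_cancel_right]
  exact norm_sq_Amap_densityMat_sub_le hA horth x y
end
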